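/- arXiv:2007.01300 — 2 statements merged into one kernel-verified Lean document; each statement's English description precedes it below -/
import Mathlib

section
/- Let G be a finite abelian group and S ⊆ G a symmetric subset with 0 ∉ S, with adjacency matrices A of X(G,S) and A⁺ of X⁺(G,S). If both spectra are symmetric, i.e. m(λ) = m(−λ) and m⁺(λ) = m⁺(−λ) for every real number λ, then A and A⁺ are isospectral: they have the same characteristic polynomial. -/
open Polynomial Matrix Finset

noncomputable section

/-- Adjacency matrix of the Cayley graph `X(G,S)`. -/
def cayleyAdj (G : Type*) [AddCommGroup G] [DecidableEq G] (S : Finset G) :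
    Matrix G G ℝ := fun v w => if w - v ∈ S then 1 else 0

/-- Adjacency matrix of the Cayley sum graph `X⁺(G,S)`. -/
def cayleySumAdj (G : Type*) [AddCommGroup G] [DecidableEq G] (S : Finset G) :
    Matrix G G ℝ := fun v w => if v + w ∈ S then 1 else 0

theorem Matrix.charpoly_neg {n R : Type*} [Fintype n] [DecidableEq n] [CommRing R]
    (M : Matrix n n R) :
    (-M).charpoly = (-1) ^ Fintype.card n * M.charpoly.comp (-X) := by
  have h : (-M).charmatrix = -(compRingHom (-X)).mapMatrix M.charmatrix := by
    ext1 i j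
    by_cases hij : i = j
    · subst hij
      simp [charmatrix_apply_eq, add_comm]
    · simp [charmatrix_apply_ne _ _ _ hij]
  rw [Matrix.charpoly, h, det_neg, ← RingHom.map_det]
  rfl

/-- `det (X - M) * det (X + M)` depends only on the square of `M`. -/
theorem Matrix.charpoly_mul_charpoly_neg {n R : Type*} [Fintype n] [DecidableEq n] [CommRing R]
    (M : Matrix n n R) :
    M.charpoly * (-M).charpoly = (Matrix.scalar n (X : R[X]) ^ 2 - C.mapMatrix (M * M)).det := by
  have h : Commute (Matrix.scalar n (X : R[X])) (C.mapMatrix M) :=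
    scalar_commute _ (fun r => Commute.all _ r) _
  rw [Matrix.charpoly, Matrix.charpoly, ← det_mul, charmatrix, charmatrix, map_neg,
    sub_neg_eq_add, map_mul, sq, h.mul_self_sub_mul_self_eq']

/-- A Hermitian matrix whose real spectrum is symmetric about zero has the same characteristic
polynomial as its negative. -/
theorem Matrix.IsHermitian.charpoly_neg_eq {n : Type*} [Fintype n] [DecidableEq n]
    {M : Matrix n n ℝ} (hM : M.IsHermitian)
    (h : ∀ x : ℝ, M.charpoly.rootMultiplicity x = M.charpoly.rootMultiplicity (-x)) :
    (-M).charpoly = M.charpoly := by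
  have hroots : (-M).charpoly.roots = M.charpoly.roots := by
    have hneg : (-M).charpoly.roots = M.charpoly.roots.map fun x => -x := by
      rw [charpoly_neg, ← roots_comp_neg_X]
      rcases neg_one_pow_eq_or ℝ[X] (Fintype.card n) with h1 | h1 <;> simp [h1]
    ext x
    rw [hneg, ← neg_neg x, Multiset.count_map_eq_count' _ _ neg_injective, neg_neg,
      count_roots, count_roots, ← h]
  rw [hM.neg.splits_charpoly.eq_prod_roots_of_monic (charpoly_monic _), hroots,
    ← hM.splits_charpoly.eq_prod_roots_of_monic (charpoly_monic _)]

/-- Two Hermitian matrices with the same square and spectra symmetric about zero are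
isospectral. -/
theorem Matrix.IsHermitian.charpoly_eq_of_mul_self_eq {n : Type*} [Fintype n] [DecidableEq n]
    {M N : Matrix n n ℝ} (hM : M.IsHermitian) (hN : N.IsHermitian) (hMN : M * M = N * N)
    (h : ∀ x : ℝ, M.charpoly.rootMultiplicity x = M.charpoly.rootMultiplicity (-x))
    (h' : ∀ x : ℝ, N.charpoly.rootMultiplicity x = N.charpoly.rootMultiplicity (-x)) :
    M.charpoly = N.charpoly := by
  have hsq : M.charpoly * M.charpoly = N.charpoly * N.charpoly := by
    have hM' := charpoly_mul_charpoly_neg M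
    rw [hMN, ← charpoly_mul_charpoly_neg, hM.charpoly_neg_eq h, hN.charpoly_neg_eq h'] at hM'
    exact hM'
  rcases mul_self_eq_mul_self_iff.mp hsq with heq | heq
  · exact heq
  · have hlead := congrArg leadingCoeff heq
    rw [leadingCoeff_neg, (charpoly_monic M).leadingCoeff, (charpoly_monic N).leadingCoeff] at hlead
    norm_num at hlead

theorem cayleyAdj_isHermitian {G : Type*} [AddCommGroup G] [DecidableEq G] {S : Finset G}
    (hSym : ∀ s : G, -s ∈ S ↔ s ∈ S) : (cayleyAdj G S).IsHermitian := by
  ext v w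
  simp [cayleyAdj, ← hSym (w - v)]

theorem cayleySumAdj_isHermitian {G : Type*} [AddCommGroup G] [DecidableEq G] (S : Finset G) :
    (cayleySumAdj G S).IsHermitian := by
  ext v w
  simp [cayleySumAdj, add_comm]

theorem cayleyAdj_mul_self {G : Type*} [AddCommGroup G] [Fintype G] [DecidableEq G] {S : Finset G}
    (hSym : ∀ s : G, -s ∈ S ↔ s ∈ S) :
    cayleyAdj G S * cayleyAdj G S = cayleySumAdj G S * cayleySumAdj G S := by
  ext v w
  rw [mul_apply, mul_apply, ← Equiv.sum_comp (Equiv.neg G)]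
  refine Finset.sum_congr rfl fun u _ => ?_
  have hvu : -u - v ∈ S ↔ v + u ∈ S := by
    rw [← hSym (v + u), neg_add_rev, sub_eq_add_neg]
  have huw : w - -u ∈ S ↔ u + w ∈ S := by rw [sub_neg_eq_add, add_comm]
  simp only [cayleyAdj, cayleySumAdj, Equiv.neg_apply, hvu, huw]

/-- for a symmetric subset `S` (with `0 ∉ S`) of a finite abelian group `G`,
if both spectra are symmetric (`m(λ) = m(−λ)` and `m⁺(λ) = m⁺(−λ)` for all real `λ`),
then `A` and `A⁺` have the same characteristic polynomial. -/
theorem stmt4 {G : Type*} [AddCommGroup G] [Fintype G] [DecidableEq G]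
    (S : Finset G) (hS0 : (0 : G) ∉ S) (hSym : ∀ s : G, -s ∈ S ↔ s ∈ S)
    (hA : ∀ lam : ℝ, (cayleyAdj G S).charpoly.rootMultiplicity lam
        = (cayleyAdj G S).charpoly.rootMultiplicity (-lam))
    (hA' : ∀ lam : ℝ, (cayleySumAdj G S).charpoly.rootMultiplicity lam
        = (cayleySumAdj G S).charpoly.rootMultiplicity (-lam)) :
    (cayleyAdj G S).charpoly = (cayleySumAdj G S).charpoly := by
  exact (cayleyAdj_isHermitian hSym).charpoly_eq_of_mul_self_eq (cayleySumAdj_isHermitian S)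
    (cayleyAdj_mul_self hSym) hA hA'

end
end

section
/- Let G be a finite abelian group of odd order and S ⊆ G a symmetric subset with 0 ∉ S, and set n = |S|. (a) For every nontrivial complex character χ of G with e_χ ∉ {0, n, −n}, one has m⁺(e_χ) = m⁺(−e_χ) and 2·m⁺(e_χ) = m(e_χ) + m(−e_χ). (b) If there exists a nontrivial character χ of G such that −e_χ is not an eigenvalue of A (i.e. m(−e_χ) = 0), then A and A⁺ have distinct characteristic polynomials. -/
open Polynomial Matrix Finset

noncomputable section

/-- `e_χ = ∑_{s ∈ S} χ s`. -/
def eSum {G : Type*} [AddCommGroup G] (S : Finset G) (χ : AddChar G ℂ) : ℂ :=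
  ∑ s ∈ S, χ s

/-- Multiplicity of `μ : ℂ` as a root of the characteristic polynomial of a real matrix. -/
def multC {n : Type*} [Fintype n] [DecidableEq n] (M : Matrix n n ℝ) (μ : ℂ) : ℕ :=
  ((M.charpoly).map (algebraMap ℝ ℂ)).rootMultiplicity μ

/-- A real matrix with a complex eigenbasis `v`, with eigenvalues `c`, has `μ` as a characteristic
root with multiplicity the number of indices `i` such that `c i = μ`. -/
theorem multC_eq_card_filter {n ι : Type*} [Fintype n] [DecidableEq n] [Fintype ι]
    (M : Matrix n n ℝ) (v : ι → n → ℂ) (hv : LinearIndependent ℂ v)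
    (hcard : Fintype.card ι = Fintype.card n) (c : ι → ℂ)
    (h : ∀ i, (M.map (algebraMap ℝ ℂ)) *ᵥ v i = c i • v i) (μ : ℂ) :
    multC M μ = #{i | c i = μ} := by
  classical
  let b : Module.Basis ι ℂ (n → ℂ) :=
    basisOfLinearIndependentOfCardEqFinrank' v hv (by simp [hcard])
  have hb : ∀ i, b i = v i := fun i => by simp [b]
  have hdiag : LinearMap.toMatrix b b (Matrix.toLin' (M.map (algebraMap ℝ ℂ))) =
      Matrix.diagonal c := by
    ext i j
    rw [LinearMap.toMatrix_apply, Matrix.toLin'_apply, hb, h, ← hb]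
    by_cases hij : i = j
    · subst hij; simp
    · simp [Matrix.diagonal_apply_ne _ hij, Ne.symm hij]
  have hchar : M.charpoly.map (algebraMap ℝ ℂ) =
      (Multiset.map (fun a => X - C a) (Multiset.map c univ.val)).prod := by
    rw [← Matrix.charpoly_map, ← Matrix.charpoly_toLin', ← LinearMap.charpoly_toMatrix _ b, hdiag,
      Matrix.charpoly_diagonal, Multiset.map_map]
    rfl
  rw [multC, hchar, ← count_roots, roots_multiset_prod_X_sub_C, Multiset.count_map, Finset.card_def,
    Finset.filter_val]
  simp only [eq_comm]

section Characters

variable {G : Type*} [AddCommGroup G]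

theorem eSum_inv [DecidableEq G] {S : Finset G} (hSym : ∀ s : G, -s ∈ S ↔ s ∈ S)
    (χ : AddChar G ℂ) : eSum S χ⁻¹ = eSum S χ := by
  unfold eSum
  exact Finset.sum_bij' (fun s _ => -s) (fun s _ => -s) (fun s hs => (hSym s).2 hs)
    (fun s hs => (hSym s).2 hs) (by simp) (by simp) (by simp [AddChar.inv_apply])

theorem eSum_one (S : Finset G) : eSum S (1 : AddChar G ℂ) = S.card := by
  simp [eSum]

variable [Fintype G]

theorem inv_ne_self_of_odd_card (hodd : Odd (Fintype.card G)) {χ : AddChar G ℂ} (hχ : χ ≠ 1) :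
    χ⁻¹ ≠ χ := by
  intro h
  apply hχ
  have h2 : χ ^ 2 = 1 := by
    rw [pow_two]; nth_rewrite 1 [← h]; exact inv_mul_cancel χ
  obtain ⟨k, hk⟩ := hodd
  have hc : χ ^ Fintype.card G = 1 := by
    ext g
    rw [AddChar.pow_apply, ← AddChar.map_nsmul_eq_pow, card_nsmul_eq_zero]
    simp
  rwa [hk, pow_succ, pow_mul, h2, one_pow, one_mul] at hc

/-- In odd order, one can choose signs taking opposite values on a nontrivial character and its
inverse. -/
theorem exists_sign_of_odd_card (hodd : Odd (Fintype.card G)) :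
    ∃ σ : AddChar G ℂ → ℂ, (∀ χ, σ χ = 1 ∨ σ χ = -1) ∧ σ 1 = 1 ∧
      ∀ χ, χ ≠ 1 → σ χ⁻¹ = -σ χ := by
  classical
  let e := Fintype.equivFin (AddChar G ℂ)
  refine ⟨fun χ => if e χ ≤ e χ⁻¹ then 1 else -1, fun χ => ?_, by simp, fun χ hχ => ?_⟩
  · dsimp only; split_ifs <;> simp
  · have hne : e χ⁻¹ ≠ e χ := fun h => inv_ne_self_of_odd_card hodd hχ (e.injective h)
    dsimp only
    rw [inv_inv]
    rcases lt_or_gt_of_ne hne with h | h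
    · rw [if_pos h.le, if_neg h.not_ge, neg_neg]
    · rw [if_neg h.not_ge, if_pos h.le]

variable [DecidableEq G]

theorem cayleyAdj_mulVec (S : Finset G) (χ : AddChar G ℂ) :
    (cayleyAdj G S).map (algebraMap ℝ ℂ) *ᵥ (χ : G → ℂ) = eSum S χ • (χ : G → ℂ) := by
  ext v
  simp only [Matrix.mulVec, dotProduct, Matrix.map_apply, cayleyAdj, Pi.smul_apply, smul_eq_mul,
    eSum]
  rw [← Equiv.sum_comp (Equiv.addRight v), Finset.sum_mul]
  simp [AddChar.map_add_eq_mul, apply_ite, ite_mul]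

theorem cayleySumAdj_mulVec (S : Finset G) (χ : AddChar G ℂ) :
    (cayleySumAdj G S).map (algebraMap ℝ ℂ) *ᵥ (χ : G → ℂ) =
      eSum S χ • ((χ⁻¹ : AddChar G ℂ) : G → ℂ) := by
  ext v
  simp only [Matrix.mulVec, dotProduct, Matrix.map_apply, cayleySumAdj, Pi.smul_apply, smul_eq_mul,
    eSum]
  rw [← Equiv.sum_comp (Equiv.subRight v), Finset.sum_mul]
  simp [sub_eq_add_neg, AddChar.map_add_eq_mul, AddChar.inv_apply, apply_ite, ite_mul]

theorem multC_cayleyAdj (S : Finset G) (μ : ℂ) :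
    multC (cayleyAdj G S) μ = #{χ : AddChar G ℂ | eSum S χ = μ} :=
  multC_eq_card_filter _ (fun χ : AddChar G ℂ => (χ : G → ℂ)) (AddChar.linearIndependent G ℂ)
    AddChar.card_eq _ (cayleyAdj_mulVec S) μ

theorem multC_cayleySumAdj {S : Finset G} (hSym : ∀ s : G, -s ∈ S ↔ s ∈ S)
    {σ : AddChar G ℂ → ℂ} (hσ : ∀ χ, σ χ = 1 ∨ σ χ = -1) (hσ1 : σ 1 = 1)
    (hσinv : ∀ χ, χ ≠ 1 → σ χ⁻¹ = -σ χ) (μ : ℂ) :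
    multC (cayleySumAdj G S) μ = #{χ : AddChar G ℂ | σ χ * eSum S χ = μ} := by
  classical
  let τ : AddChar G ℂ → ℂ := fun χ => if χ = 1 then 0 else σ χ
  have hsq : ∀ χ, σ χ * σ χ = 1 := fun χ => by rcases hσ χ with h | h <;> simp [h]
  refine multC_eq_card_filter _
    (fun χ : AddChar G ℂ => (χ : G → ℂ) + τ χ • ((χ⁻¹ : AddChar G ℂ) : G → ℂ)) ?_
    AddChar.card_eq _ (fun χ => ?_) μ
  · rw [Fintype.linearIndependent_iff]
    intro a ha
    have hcoef : ∀ χ, a χ + a χ⁻¹ * τ χ⁻¹ = 0 := by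
      refine Fintype.linearIndependent_iff.1 (AddChar.linearIndependent G ℂ)
        (fun χ => a χ + a χ⁻¹ * τ χ⁻¹) ?_
      simp only [smul_add, add_smul, Finset.sum_add_distrib, smul_smul] at ha ⊢
      rw [← ha, ← Equiv.sum_comp (Equiv.inv (AddChar G ℂ))
        (fun χ => (a χ * τ χ) • ((χ⁻¹ : AddChar G ℂ) : G → ℂ))]
      simp
    intro χ
    have h1 := hcoef χ
    have h2 := hcoef χ⁻¹
    by_cases hχ : χ = 1
    · subst hχ; simpa [τ] using h1
    · have hχ' : χ⁻¹ ≠ 1 := inv_ne_one.2 hχ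
      simp only [τ, inv_inv, if_neg hχ, if_neg hχ', hσinv χ hχ] at h1 h2
      linear_combination (h1 + σ χ * h2 - a χ * hsq χ) / 2
  · rw [Matrix.mulVec_add, Matrix.mulVec_smul, cayleySumAdj_mulVec, cayleySumAdj_mulVec,
      eSum_inv hSym, inv_inv]
    by_cases hχ : χ = 1
    · subst hχ; simp [τ, hσ1]
    · ext g
      simp only [τ, if_neg hχ, Pi.add_apply, Pi.smul_apply, smul_eq_mul]
      linear_combination (-(eSum S χ * (χ⁻¹ : AddChar G ℂ) g)) * hsq χ

/-- The multiplicities of the Cayley sum graph in terms of those of the Cayley graph. -/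
theorem two_mul_multC_cayleySumAdj (hodd : Odd (Fintype.card G)) {S : Finset G}
    (hSym : ∀ s : G, -s ∈ S ↔ s ∈ S) (μ : ℂ) :
    2 * multC (cayleySumAdj G S) μ + (if -(S.card : ℂ) = μ then 1 else 0) =
      multC (cayleyAdj G S) μ + multC (cayleyAdj G S) (-μ) +
        (if (S.card : ℂ) = μ then 1 else 0) := by
  classical
  obtain ⟨σ, hσ, hσ1, hσinv⟩ := exists_sign_of_odd_card hodd
  have hneg : ∀ z : ℂ, z = -μ ↔ -z = μ := fun z => by rw [neg_eq_iff_eq_neg]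
  rw [multC_cayleySumAdj hSym hσ hσ1 hσinv, multC_cayleyAdj, multC_cayleyAdj, two_mul]
  simp only [Finset.card_filter, hneg]
  nth_rewrite 2 [← Equiv.sum_comp (Equiv.inv (AddChar G ℂ))]
  simp only [Equiv.inv_apply, eSum_inv hSym]
  rw [← Finset.sum_add_distrib, ← Finset.sum_add_distrib,
    ← Finset.add_sum_erase _ _ (Finset.mem_univ (1 : AddChar G ℂ)),
    ← Finset.add_sum_erase _ _ (Finset.mem_univ (1 : AddChar G ℂ))]
  have hrest : ∀ χ ∈ univ.erase (1 : AddChar G ℂ),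
      ((if σ χ * eSum S χ = μ then 1 else 0) + (if σ χ⁻¹ * eSum S χ = μ then 1 else 0) : ℕ) =
        (if eSum S χ = μ then 1 else 0) + (if -eSum S χ = μ then 1 else 0) := by
    intro χ hχ
    rw [hσinv χ (Finset.ne_of_mem_erase hχ)]
    rcases hσ χ with h | h <;> simp [h, add_comm]
  rw [Finset.sum_congr rfl hrest]
  simp only [inv_one, hσ1, one_mul, eSum_one]
  ring

theorem multC_cayleyAdj_eSum_pos (S : Finset G) (χ : AddChar G ℂ) :
    0 < multC (cayleyAdj G S) (eSum S χ) := by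
  rw [multC_cayleyAdj]
  exact Finset.card_pos.2 ⟨χ, by simp⟩

theorem one_lt_multC_cayleyAdj_card {S : Finset G} {χ : AddChar G ℂ} (hχ : χ ≠ 1)
    (h : eSum S χ = S.card) : 1 < multC (cayleyAdj G S) S.card := by
  rw [multC_cayleyAdj]
  exact Finset.one_lt_card.2 ⟨χ, by simp [h], 1, by simp [eSum_one], hχ⟩

end Characters

/-- let `G` be a finite abelian group of odd order and `S` a symmetric subset with
`0 ∉ S`, `n = |S|`.  (a) For every nontrivial character `χ` with `e_χ ∉ {0, n, −n}` one has
`m⁺(e_χ) = m⁺(−e_χ)` and `2·m⁺(e_χ) = m(e_χ) + m(−e_χ)`.  (b) If some nontrivial character `χ`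
satisfies `m(−e_χ) = 0`, then `A` and `A⁺` have distinct characteristic polynomials. -/
theorem stmt5 {G : Type*} [AddCommGroup G] [Fintype G] [DecidableEq G]
    (hodd : Odd (Fintype.card G))
    (S : Finset G) (hS0 : (0 : G) ∉ S) (hSym : ∀ s : G, -s ∈ S ↔ s ∈ S) :
    (∀ χ : AddChar G ℂ, χ ≠ 1 →
      eSum S χ ≠ 0 → eSum S χ ≠ (S.card : ℂ) → eSum S χ ≠ -(S.card : ℂ) →
      multC (cayleySumAdj G S) (eSum S χ) = multC (cayleySumAdj G S) (-eSum S χ) ∧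
      2 * multC (cayleySumAdj G S) (eSum S χ)
        = multC (cayleyAdj G S) (eSum S χ) + multC (cayleyAdj G S) (-eSum S χ)) ∧
    ((∃ χ : AddChar G ℂ, χ ≠ 1 ∧ multC (cayleyAdj G S) (-eSum S χ) = 0) →
      (cayleyAdj G S).charpoly ≠ (cayleySumAdj G S).charpoly) := by
  refine ⟨fun χ _ _ hn hn' => ?_, ?_⟩
  · have h1 := two_mul_multC_cayleySumAdj hodd hSym (eSum S χ)
    have h2 := two_mul_multC_cayleySumAdj hodd hSym (-eSum S χ)
    rw [if_neg (Ne.symm hn), if_neg (Ne.symm hn')] at h1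
    rw [if_neg (fun h => hn (neg_injective h).symm),
      if_neg (fun h => hn' (by rw [h, neg_neg])), neg_neg] at h2
    omega
  · rintro ⟨χ, hχ, h0⟩ hEq
    have hm : multC (cayleySumAdj G S) (-eSum S χ) = 0 := by
      rw [← h0, multC, multC, hEq]
    have h := two_mul_multC_cayleySumAdj hodd hSym (-eSum S χ)
    have hpos := multC_cayleyAdj_eSum_pos S χ
    rw [hm, h0, neg_neg] at h
    by_cases hn : eSum S χ = S.card
    · have h2 := one_lt_multC_cayleyAdj_card hχ hn
      rw [← hn] at h2
      split_ifs at h <;> omega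
    · rw [if_neg (fun h' => hn (neg_injective h').symm)] at h
      omega

end
end
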